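/- arXiv:2201.02817 — 10 statements merged into one kernel-verified Lean document; each statement's English description precedes it below -/
import Mathlib

section
/- Let c₁, c₂, c₃ be nonzero elements of R_m such that c₁ | c₂ | c₃ (divisibility in R_m). If γ₂₁ is any generating solution of the equation c₁·x = c₂ and γ₃₂ is any generating solution of the equation c₂·x = c₃, then the product γ₂₁·γ₃₂ is a generating solution of the equation c₁·x = c₃. -/
/-- `R` has stable range 1.5: for all `a, b ∈ R` and nonzero `c` with
`gcd(a, b, c) = 1` (i.e. the ideal generated by `a, b, c` is all of `R`),
there is `r` with `gcd(a + b*r, c) = 1`. -/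
def HasStableRange15 (R : Type*) [CommRing R] : Prop :=
  ∀ a b c : R, c ≠ 0 → Ideal.span ({a, b, c} : Set R) = ⊤ →
    ∃ r : R, Ideal.span ({a + b * r, c} : Set R) = ⊤

/-- `x₀` is a generating solution of the linear equation `a * x = b`:
it is a solution that divides every solution. -/
def IsGeneratingSolution {S : Type*} [CommRing S] (a b x₀ : S) : Prop :=
  a * x₀ = b ∧ ∀ x : S, a * x = b → x₀ ∣ x

theorem generating_solution_mul
    {R : Type*} [CommRing R] [IsDomain R] [IsBezout R]
    (hsr : HasStableRange15 R)
    (m : R) (hm0 : m ≠ 0) (hmu : ¬ IsUnit m)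
    (c₁ c₂ c₃ : R ⧸ Ideal.span ({m} : Set R))
    (hc₁ : c₁ ≠ 0) (hc₂ : c₂ ≠ 0) (hc₃ : c₃ ≠ 0)
    (h12 : c₁ ∣ c₂) (h23 : c₂ ∣ c₃)
    (γ₂₁ γ₃₂ : R ⧸ Ideal.span ({m} : Set R))
    (hγ₂₁ : IsGeneratingSolution c₁ c₂ γ₂₁)
    (hγ₃₂ : IsGeneratingSolution c₂ c₃ γ₃₂) :
    IsGeneratingSolution c₁ c₃ (γ₂₁ * γ₃₂) := by
  obtain ⟨h1, g1⟩ := hγ₂₁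
  obtain ⟨h2, g2⟩ := hγ₃₂
  refine ⟨by rw [← mul_assoc, h1, h2], fun x hx => ?_⟩
  -- `x - γ₂₁ * γ₃₂` annihilates `c₁`
  have hy : c₁ * (x - γ₂₁ * γ₃₂) = 0 := by
    rw [mul_sub, hx, ← mul_assoc, h1, h2, sub_self]
  have d1 : γ₂₁ ∣ γ₂₁ + (x - γ₂₁ * γ₃₂) := g1 _ (by rw [mul_add, hy, h1, add_zero])
  obtain ⟨t, ht⟩ := (dvd_add_right (dvd_refl γ₂₁)).1 d1
  have ht0 : c₂ * t = 0 := by rw [← h1, mul_assoc, ← ht, hy]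
  have d2 : γ₃₂ ∣ γ₃₂ + t := g2 _ (by rw [mul_add, ht0, h2, add_zero])
  obtain ⟨s, hs⟩ := (dvd_add_right (dvd_refl γ₃₂)).1 d2
  refine ⟨1 + s, ?_⟩
  rw [eq_add_of_sub_eq ht, hs]
  ring
end

section
/- Let φ₁ | φ₂ | ⋯ | φ_t be nonzero elements of R_m (divisibility in R_m), and for each i = 1, …, t−1 fix a generating solution g_i of the equation φ_i·x = φ_{i+1}. Then for all indices 1 ≤ q < p ≤ t, the product g_q·g_{q+1}⋯g_{p−1} is a generating solution of the equation φ_q·x = φ_p. -/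
theorem IsGeneratingSolution.comp {S : Type*} [CommRing S] {a b c g h : S}
    (hg : IsGeneratingSolution a b g) (hh : IsGeneratingSolution b c h) :
    IsGeneratingSolution a c (g * h) := by
  obtain ⟨h1, h2⟩ := hg
  obtain ⟨h3, h4⟩ := hh
  refine ⟨by rw [← mul_assoc, h1, h3], fun x hx => ?_⟩
  obtain ⟨k, hk⟩ := h2 (g + (x - g * h)) (by
    have h5 : a * g * h = c := by rw [h1, h3]
    linear_combination h1 + hx - h5)
  have hxg : x = g * (k - 1 + h) := by linear_combination hk
  have hz : b * (k - 1 + h) = c := by rw [← h1, mul_assoc, ← hxg, hx]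
  rw [hxg]
  exact mul_dvd_mul_left g (h4 _ hz)

theorem generating_solution_prod
    {R : Type*} [CommRing R] [IsDomain R] [IsBezout R]
    (hsr : HasStableRange15 R)
    (m : R) (hm0 : m ≠ 0) (hmu : ¬ IsUnit m)
    (t : ℕ) (ht : 1 ≤ t)
    (φ : ℕ → R ⧸ Ideal.span ({m} : Set R))
    (hφ0 : ∀ i, 1 ≤ i → i ≤ t → φ i ≠ 0)
    (hchain : ∀ i, 1 ≤ i → i < t → φ i ∣ φ (i + 1))
    (g : ℕ → R ⧸ Ideal.span ({m} : Set R))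
    (hg : ∀ i, 1 ≤ i → i < t → IsGeneratingSolution (φ i) (φ (i + 1)) (g i)) :
    ∀ q p, 1 ≤ q → q < p → p ≤ t →
      IsGeneratingSolution (φ q) (φ p) (∏ l ∈ Finset.Ico q p, g l) := by
  intro q p hq hqp
  induction p, hqp using Nat.le_induction with
  | base =>
    intro hp
    simpa using hg q hq (by omega)
  | succ p hp ih =>
    intro hpt
    rw [Finset.prod_Ico_succ_top (by omega)]
    exact (ih (by omega)).comp (hg p (by omega) (by omega))
end

section
/- Let c, d ∈ R with c | d in R and with nonzero images c̄, d̄ in R_m. Put μ_c = gcd(c, m) and μ_d = gcd(d, m), and suppose ē_c and ē_d are units of R_m such that c̄ = μ̄_c·ē_c and d̄ = μ̄_d·ē_d. Then μ_c divides μ_d in R, and the element (μ_d/μ_c)‾ · ē_d · ē_c⁻¹ of R_m is a generating solution of the equation c̄·x = d̄. -/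
/-- `μ` is a greatest common divisor of `a` and `b`. -/
def IsGCDOf {R : Type*} [CommRing R] (μ a b : R) : Prop :=
  μ ∣ a ∧ μ ∣ b ∧ ∀ d : R, d ∣ a → d ∣ b → d ∣ μ

theorem generating_solution_explicit_form
    {R : Type*} [CommRing R] [IsDomain R] [IsBezout R]
    (hsr : HasStableRange15 R)
    (m : R) (hm0 : m ≠ 0) (hmu : ¬ IsUnit m)
    (c d : R) (hcd : c ∣ d)
    (hc : Ideal.Quotient.mk (Ideal.span ({m} : Set R)) c ≠ 0)
    (hd : Ideal.Quotient.mk (Ideal.span ({m} : Set R)) d ≠ 0)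
    (μc μd : R) (hμc : IsGCDOf μc c m) (hμd : IsGCDOf μd d m)
    (ec ed : (R ⧸ Ideal.span ({m} : Set R))ˣ)
    (hec : Ideal.Quotient.mk (Ideal.span ({m} : Set R)) c =
      Ideal.Quotient.mk (Ideal.span ({m} : Set R)) μc * (ec : R ⧸ Ideal.span ({m} : Set R)))
    (hed : Ideal.Quotient.mk (Ideal.span ({m} : Set R)) d =
      Ideal.Quotient.mk (Ideal.span ({m} : Set R)) μd * (ed : R ⧸ Ideal.span ({m} : Set R))) :
    μc ∣ μd ∧
    ∀ q : R, μd = μc * q →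
      IsGeneratingSolution
        (Ideal.Quotient.mk (Ideal.span ({m} : Set R)) c)
        (Ideal.Quotient.mk (Ideal.span ({m} : Set R)) d)
        (Ideal.Quotient.mk (Ideal.span ({m} : Set R)) q *
          (ed : R ⧸ Ideal.span ({m} : Set R)) *
          ((ec⁻¹ : (R ⧸ Ideal.span ({m} : Set R))ˣ) : R ⧸ Ideal.span ({m} : Set R))) := by
  have h1 : μc ∣ μd := hμd.2.2 _ (hμc.1.trans hcd) hμc.2.1
  refine ⟨h1, ?_⟩
  intro q hq
  have hμc0 : μc ≠ 0 := by
    rintro rfl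
    exact hm0 (zero_dvd_iff.mp hμc.2.1)
  refine ⟨?_, ?_⟩
  · rw [hec, hed, hq, map_mul]
    linear_combination (Ideal.Quotient.mk (Ideal.span ({m} : Set R)) μc *
      Ideal.Quotient.mk (Ideal.span ({m} : Set R)) q * ed) * ec.mul_inv
  · intro x hx
    obtain ⟨y, hy⟩ := Ideal.Quotient.mk_surjective
      ((ec : R ⧸ Ideal.span ({m} : Set R)) * x * ((ed⁻¹ : (R ⧸ Ideal.span ({m} : Set R))ˣ) :
        R ⧸ Ideal.span ({m} : Set R)))
    have h2 : Ideal.Quotient.mk (Ideal.span ({m} : Set R)) (μc * y) =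
        Ideal.Quotient.mk (Ideal.span ({m} : Set R)) μd := by
      rw [map_mul, hy]
      rw [hec, hed] at hx
      linear_combination ((ed⁻¹ : (R ⧸ Ideal.span ({m} : Set R))ˣ) :
        R ⧸ Ideal.span ({m} : Set R)) * hx +
        Ideal.Quotient.mk (Ideal.span ({m} : Set R)) μd * ed.mul_inv
    rw [Ideal.Quotient.eq, Ideal.mem_span_singleton] at h2
    have h3 : μc * q ∣ μc * (y - q) := by
      have := hμd.2.1.trans h2
      rw [hq] at this
      rwa [mul_sub]
    have h4 : q ∣ y := (dvd_sub_self_right).mp ((mul_dvd_mul_iff_left hμc0).mp h3)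
    obtain ⟨z, rfl⟩ := h4
    refine ⟨Ideal.Quotient.mk (Ideal.span ({m} : Set R)) z, ?_⟩
    rw [map_mul] at hy
    linear_combination (-(ed : R ⧸ Ideal.span ({m} : Set R)) *
      ((ec⁻¹ : (R ⧸ Ideal.span ({m} : Set R))ˣ) : R ⧸ Ideal.span ({m} : Set R))) * hy
      - x * ec.mul_inv * (ed : R ⧸ Ideal.span ({m} : Set R)) *
        ((ed⁻¹ : (R ⧸ Ideal.span ({m} : Set R))ˣ) : R ⧸ Ideal.span ({m} : Set R))
      - x * ed.mul_inv
end

section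
/- Let c₁, c₂ ∈ R have nonzero images c̄₁, c̄₂ in R_m with c̄₁ | c̄₂ in R_m. Put μ_i = gcd(c_i, m) for i = 1, 2, and suppose ē₁, ē₂ are units of R_m such that c̄_i = μ̄_i·ē_i. Define ᾱ_i := (m/μ_i)‾ · ē_i ∈ R_m. Then μ₁ divides μ₂ in R, and the element σ := (μ₂/μ₁)‾ · ē₁ · ē₂⁻¹ is a generating solution of the equation ᾱ₂·x = ᾱ₁. -/
theorem generating_solution_annihilator_equation
    {R : Type*} [CommRing R] [IsDomain R] [IsBezout R]
    (hsr : HasStableRange15 R)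
    (m : R) (hm0 : m ≠ 0) (hmu : ¬ IsUnit m)
    (c₁ c₂ : R)
    (hc₁ : Ideal.Quotient.mk (Ideal.span ({m} : Set R)) c₁ ≠ 0)
    (hc₂ : Ideal.Quotient.mk (Ideal.span ({m} : Set R)) c₂ ≠ 0)
    (hdvd : Ideal.Quotient.mk (Ideal.span ({m} : Set R)) c₁ ∣
      Ideal.Quotient.mk (Ideal.span ({m} : Set R)) c₂)
    (μ₁ μ₂ : R) (hμ₁ : IsGCDOf μ₁ c₁ m) (hμ₂ : IsGCDOf μ₂ c₂ m)
    (e₁ e₂ : (R ⧸ Ideal.span ({m} : Set R))ˣ)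
    (he₁ : Ideal.Quotient.mk (Ideal.span ({m} : Set R)) c₁ =
      Ideal.Quotient.mk (Ideal.span ({m} : Set R)) μ₁ * (e₁ : R ⧸ Ideal.span ({m} : Set R)))
    (he₂ : Ideal.Quotient.mk (Ideal.span ({m} : Set R)) c₂ =
      Ideal.Quotient.mk (Ideal.span ({m} : Set R)) μ₂ * (e₂ : R ⧸ Ideal.span ({m} : Set R))) :
    μ₁ ∣ μ₂ ∧
    ∀ a₁ a₂ q : R, m = μ₁ * a₁ → m = μ₂ * a₂ → μ₂ = μ₁ * q →
      IsGeneratingSolution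
        (Ideal.Quotient.mk (Ideal.span ({m} : Set R)) a₂ *
          (e₂ : R ⧸ Ideal.span ({m} : Set R)))
        (Ideal.Quotient.mk (Ideal.span ({m} : Set R)) a₁ *
          (e₁ : R ⧸ Ideal.span ({m} : Set R)))
        (Ideal.Quotient.mk (Ideal.span ({m} : Set R)) q *
          (e₁ : R ⧸ Ideal.span ({m} : Set R)) *
          ((e₂⁻¹ : (R ⧸ Ideal.span ({m} : Set R))ˣ) : R ⧸ Ideal.span ({m} : Set R))) := by
  constructor
  · apply hμ₂.2.2 μ₁ _ hμ₁.2.1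
    obtain ⟨k, hk⟩ := hdvd
    obtain ⟨k, rfl⟩ := Ideal.Quotient.mk_surjective k
    rw [← map_mul, Ideal.Quotient.eq, Ideal.mem_span_singleton] at hk
    have h1 : μ₁ ∣ c₂ - c₁ * k := hμ₁.2.1.trans hk
    have h2 : μ₁ ∣ c₁ * k := hμ₁.1.mul_right k
    have h3 := dvd_add h1 h2
    rwa [sub_add_cancel] at h3
  · intro a₁ a₂ q h1 h2 hq
    have hμ0 : μ₁ ≠ 0 := by
      rintro rfl
      exact hm0 (by rw [h1, zero_mul])
    have ha0 : a₂ ≠ 0 := by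
      rintro rfl
      exact hm0 (by rw [h2, mul_zero])
    have ha : a₁ = a₂ * q := by
      apply mul_left_cancel₀ hμ0
      rw [← h1, h2, hq]
      ring
    have hinv : (e₂ : R ⧸ Ideal.span ({m} : Set R)) *
        ((e₂⁻¹ : (R ⧸ Ideal.span ({m} : Set R))ˣ) : R ⧸ Ideal.span ({m} : Set R)) = 1 :=
      Units.mul_inv e₂
    refine ⟨?_, ?_⟩
    · rw [ha, map_mul]
      linear_combination (Ideal.Quotient.mk (Ideal.span ({m} : Set R)) a₂ *
        Ideal.Quotient.mk (Ideal.span ({m} : Set R)) q * e₁) * hinv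
    · intro x hx
      rw [Units.mul_right_dvd, Units.mul_right_dvd]
      rw [← Units.dvd_mul_right (u := e₂)]
      obtain ⟨y, hy⟩ := Ideal.Quotient.mk_surjective
        (x * (e₂ : R ⧸ Ideal.span ({m} : Set R)) -
          Ideal.Quotient.mk (Ideal.span ({m} : Set R)) q * (e₁ : R ⧸ Ideal.span ({m} : Set R)))
      have hz : Ideal.Quotient.mk (Ideal.span ({m} : Set R)) (a₂ * y) = 0 := by
        rw [ha, map_mul] at hx
        rw [map_mul, hy]
        linear_combination hx
      rw [Ideal.Quotient.eq_zero_iff_mem, Ideal.mem_span_singleton, h2, mul_comm μ₂] at hz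
      have hd : q ∣ y := (Dvd.intro_left μ₁ hq.symm).trans ((mul_dvd_mul_iff_left ha0).1 hz)
      have hd2 := map_dvd (Ideal.Quotient.mk (Ideal.span ({m} : Set R))) hd
      rw [hy] at hd2
      have h3 := dvd_add hd2 (Dvd.intro
        (e₁ : R ⧸ Ideal.span ({m} : Set R)) (rfl :
          Ideal.Quotient.mk (Ideal.span ({m} : Set R)) q * e₁ = _))
      rwa [sub_add_cancel] at h3
end

section
/- Let R be a commutative ring, n ≥ 1, and a₂, …, a_n ∈ R. Define the n×n matrix A over R by A_{ij} = 1 if i ≤ j and A_{ij} = a_{j+1}·a_{j+2}⋯a_i if i > j. Then for every permutation σ of {1, …, n}, ∏_{i=1}^n A_{i,σ(i)} = ∏_{i=1}^n A_{σ(i),i}; consequently, the term of σ in the permutation expansion of det(A) equals the term of σ⁻¹ in the expansion of det(A), and equals the term of σ in the permutation expansion of det(Aᵀ). -/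
theorem card_cross {n : ℕ} (P : Fin n → Prop) [DecidablePred P] (σ : Equiv.Perm (Fin n)) :
    (Finset.univ.filter (fun i => P (σ i) ∧ ¬ P i)).card =
      (Finset.univ.filter (fun i => P i ∧ ¬ P (σ i))).card := by
  have h : (∑ i, if P (σ i) then 1 else 0) = ∑ i, if P i then 1 else 0 :=
    Equiv.sum_comp σ (fun i => if P i then 1 else 0)
  have h2 : (∑ i, ((if P (σ i) ∧ ¬ P i then 1 else 0) + if P i then 1 else 0)) =
      ∑ i, ((if P i ∧ ¬ P (σ i) then 1 else 0) + if P (σ i) then 1 else 0) := by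
    refine Finset.sum_congr rfl fun i _ => ?_
    by_cases h1 : P i <;> by_cases h2 : P (σ i) <;> simp [h1, h2]
  rw [Finset.sum_add_distrib, Finset.sum_add_distrib, h] at h2
  rw [Finset.card_filter, Finset.card_filter]
  exact Nat.add_right_cancel h2

theorem det_terms_symmetric
    {R : Type*} [CommRing R] (n : ℕ) (hn : 1 ≤ n) (a : ℕ → R)
    (A : Matrix (Fin n) (Fin n) R)
    (hA : ∀ i j : Fin n, A i j =
      if (i : ℕ) ≤ (j : ℕ) then 1
      else ∏ l ∈ Finset.Icc ((j : ℕ) + 2) ((i : ℕ) + 1), a l) :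
    ∀ σ : Equiv.Perm (Fin n),
      (∏ i, A i (σ i) = ∏ i, A (σ i) i) ∧
      (Equiv.Perm.sign σ : ℤ) • ∏ i, A i (σ i) =
        (Equiv.Perm.sign σ⁻¹ : ℤ) • ∏ i, A i (σ⁻¹ i) ∧
      (Equiv.Perm.sign σ : ℤ) • ∏ i, A i (σ i) =
        (Equiv.Perm.sign σ : ℤ) • ∏ i, A.transpose i (σ i) := by
  intro σ
  have key : ∀ i j : Fin n, A i j = ∏ l ∈ Finset.range (n + 2),
      if ((j : ℕ) + 2 ≤ l ∧ ¬ (i : ℕ) + 2 ≤ l) then a l else 1 := by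
    intro i j
    rw [hA, ← Finset.prod_filter]
    have hi := i.2
    split_ifs with h
    · rw [Finset.filter_false_of_mem, Finset.prod_empty]
      intro l _
      omega
    · refine Finset.prod_congr ?_ fun _ _ => rfl
      ext l
      simp only [Finset.mem_Icc, Finset.mem_filter, Finset.mem_range]
      omega
  have main : ∏ i, A i (σ i) = ∏ i, A (σ i) i := by
    simp only [key]
    rw [Finset.prod_comm]
    conv_rhs => rw [Finset.prod_comm]
    refine Finset.prod_congr rfl fun l _ => ?_
    rw [← Finset.prod_filter, ← Finset.prod_filter, Finset.prod_const, Finset.prod_const]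
    congr 1
    exact card_cross (fun i : Fin n => (i : ℕ) + 2 ≤ l) σ
  have inv : ∏ i, A i (σ⁻¹ i) = ∏ i, A (σ i) i := by
    rw [← Equiv.prod_comp σ]
    simp
  refine ⟨main, ?_, ?_⟩
  · rw [inv, Equiv.Perm.sign_inv, main]
  · simp only [Matrix.transpose_apply, main]
end

section
/- Let R be a commutative ring, n ≥ 1, a₂, …, a_n ∈ R, and define λ_{ij} = 1 if i ≤ j and λ_{ij} = a_{j+1}·a_{j+2}⋯a_i if i > j (1 ≤ i, j ≤ n). Let h_{ij} ∈ R (1 ≤ i, j ≤ n) and define the n×n matrices A and B by A_{ij} = λ_{ij}·h_{ij} and B_{ij} = λ_{ji}·h_{ij}. Then for every permutation σ of {1, …, n}, sign(σ)·∏_{i=1}^n A_{i,σ(i)} = sign(σ)·∏_{i=1}^n B_{i,σ(i)}; that is, the corresponding terms of the permutation expansions of det(A) and det(B) coincide. -/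
theorem det_terms_coincide
    {R : Type*} [CommRing R] (n : ℕ) (hn : 1 ≤ n) (a : ℕ → R)
    (lam : Fin n → Fin n → R)
    (hlam : ∀ i j : Fin n, lam i j =
      if (i : ℕ) ≤ (j : ℕ) then 1
      else ∏ l ∈ Finset.Icc ((j : ℕ) + 2) ((i : ℕ) + 1), a l)
    (h : Fin n → Fin n → R)
    (A B : Matrix (Fin n) (Fin n) R)
    (hA : ∀ i j : Fin n, A i j = lam i j * h i j)
    (hB : ∀ i j : Fin n, B i j = lam j i * h i j) :
    ∀ σ : Equiv.Perm (Fin n),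
      (Equiv.Perm.sign σ : ℤ) • ∏ i, A i (σ i) =
        (Equiv.Perm.sign σ : ℤ) • ∏ i, B i (σ i) := by
  intro σ
  have key : ∀ i j : Fin n, lam i j = ∏ l ∈ Finset.range (n + 2),
      if (j : ℕ) + 2 ≤ l ∧ l ≤ (i : ℕ) + 1 then a l else 1 := by
    intro i j
    rw [hlam, ← Finset.prod_filter]
    have e : Finset.filter (fun l => (j : ℕ) + 2 ≤ l ∧ l ≤ (i : ℕ) + 1) (Finset.range (n + 2))
        = Finset.Icc ((j : ℕ) + 2) ((i : ℕ) + 1) := by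
      ext l
      simp only [Finset.mem_filter, Finset.mem_range, Finset.mem_Icc]
      have := i.2
      omega
    rw [e]
    split_ifs with hij
    · rw [Finset.Icc_eq_empty (by omega), Finset.prod_empty]
    · rfl
  have main : ∏ i, lam i (σ i) = ∏ i, lam (σ i) i := by
    simp only [key]
    rw [Finset.prod_comm]
    conv_rhs => rw [Finset.prod_comm]
    refine Finset.prod_congr rfl fun l _ => ?_
    rw [← Finset.prod_filter, ← Finset.prod_filter, Finset.prod_const, Finset.prod_const]
    congr 1
    have hc : (Finset.univ.filter fun i : Fin n => ((σ i : Fin n) : ℕ) + 2 ≤ l).card =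
        (Finset.univ.filter fun i : Fin n => (i : ℕ) + 2 ≤ l).card :=
      Finset.card_equiv σ (by simp)
    have := Finset.card_sdiff_comm hc
    convert this using 2
    · ext i
      simp only [Finset.mem_filter, Finset.mem_sdiff, Finset.mem_univ, true_and]
      omega
    · ext i
      simp only [Finset.mem_filter, Finset.mem_sdiff, Finset.mem_univ, true_and]
      omega
  simp only [hA, hB, Finset.prod_mul_distrib, main]
end

section
/- Suppose H ∈ GL_n(R_m) belongs to the Zelisko group G_Φ, i.e. HΦ = ΦS for some S ∈ GL_n(R_m). Then for all indices with t ≤ j < i ≤ k, every generating solution of the equation φ_j·x = φ_i divides H_{ij} in R_m. -/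
theorem zelisko_block22_divisible
    {R : Type*} [CommRing R] [IsDomain R] [IsBezout R]
    (hsr : HasStableRange15 R)
    (m : R) (hm0 : m ≠ 0) (hmu : ¬ IsUnit m)
    (n t k : ℕ) (ht : 1 ≤ t) (htk : t ≤ k) (hkn : k ≤ n)
    (φ : ℕ → R ⧸ Ideal.span ({m} : Set R))
    (hchain : ∀ i, t ≤ i → i < k → φ i ∣ φ (i + 1))
    (hφk : φ k ≠ 0) (hφt : ¬ IsUnit (φ t))
    (Φ : Matrix (Fin n) (Fin n) (R ⧸ Ideal.span ({m} : Set R)))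
    (hΦ : Φ = Matrix.diagonal (fun i : Fin n =>
      if (i : ℕ) + 1 < t then 1
      else if (i : ℕ) + 1 ≤ k then φ ((i : ℕ) + 1) else 0))
    (H : Matrix (Fin n) (Fin n) (R ⧸ Ideal.span ({m} : Set R)))
    (hH : IsUnit H)
    (hZel : ∃ S : Matrix (Fin n) (Fin n) (R ⧸ Ideal.span ({m} : Set R)),
      IsUnit S ∧ H * Φ = Φ * S) :
    ∀ i j : Fin n, t ≤ (j : ℕ) + 1 → (j : ℕ) + 1 < (i : ℕ) + 1 → (i : ℕ) + 1 ≤ k →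
      ∀ g : R ⧸ Ideal.span ({m} : Set R),
        IsGeneratingSolution (φ ((j : ℕ) + 1)) (φ ((i : ℕ) + 1)) g → g ∣ H i j := by
  obtain ⟨S, -, hS⟩ := hZel
  intro i j htj hji hik g hg
  obtain ⟨hg1, hg2⟩ := hg
  have h := congrFun (congrFun hS i) j
  rw [hΦ, Matrix.mul_diagonal, Matrix.diagonal_mul] at h
  rw [if_neg (by omega), if_pos (by omega), if_neg (by omega), if_pos hik] at h
  have h2 : g ∣ g + (H i j - g * S i j) := by
    apply hg2
    linear_combination h + (1 - S i j) * hg1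
  have h3 : g ∣ H i j - g * S i j := (dvd_add_right (dvd_refl g)).mp h2
  exact (dvd_sub_left (Dvd.intro _ rfl)).mp h3
end

section
/- Assume 1 < t and k < n. For t ≤ l ≤ k−1 fix a generating solution g_l of the equation φ_l·x = φ_{l+1}, let ᾱ_k ∈ R_m be a generator of the annihilator ideal Ann(φ_k) = {y ∈ R_m : φ_k·y = 0}, and set ᾱ_j := g_j·g_{j+1}⋯g_{k−1}·ᾱ_k for t ≤ j < k. Suppose H ∈ GL_n(R_m) satisfies: H_{ij} = 0 for all k < i ≤ n and 1 ≤ j < t; φ_i | H_{ij} for all t ≤ i ≤ k and 1 ≤ j < t; g_j·g_{j+1}⋯g_{i−1} | H_{ij} for all t ≤ j < i ≤ k; and ᾱ_j | H_{ij} for all k < i ≤ n and t ≤ j ≤ k. Then H belongs to the Zelisko group G_Φ, i.e. there exists S ∈ GL_n(R_m) with HΦ = ΦS. -/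
/-- Stable range one for commutative rings. -/
def ZSR1 (S : Type*) [CommRing S] : Prop :=
  ∀ a y : S, (∃ x z, a * x + y * z = 1) → ∃ z, IsUnit (a + y * z)

theorem zsr1_quot {R : Type*} [CommRing R] (hsr : HasStableRange15 R) (m : R) (hm0 : m ≠ 0) :
    ZSR1 (R ⧸ Ideal.span ({m} : Set R)) := by
  rintro a y ⟨x, z, h⟩
  obtain ⟨a, rfl⟩ := Ideal.Quotient.mk_surjective a
  obtain ⟨y, rfl⟩ := Ideal.Quotient.mk_surjective y
  obtain ⟨x, rfl⟩ := Ideal.Quotient.mk_surjective x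
  obtain ⟨z, rfl⟩ := Ideal.Quotient.mk_surjective z
  rw [← map_mul, ← map_mul, ← map_add, ← map_one (Ideal.Quotient.mk _), eq_comm,
    Ideal.Quotient.eq, Ideal.mem_span_singleton] at h
  obtain ⟨w, hw⟩ := h
  have htop : Ideal.span ({a, y, m} : Set R) = ⊤ := by
    rw [Ideal.eq_top_iff_one]
    have ha : a ∈ Ideal.span ({a, y, m} : Set R) := Ideal.subset_span (by simp)
    have hy : y ∈ Ideal.span ({a, y, m} : Set R) := Ideal.subset_span (by simp)
    have hm : m ∈ Ideal.span ({a, y, m} : Set R) := Ideal.subset_span (by simp)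
    have e : (1 : R) = (x * a + z * y) + w * m := by linear_combination hw
    rw [e]
    exact add_mem (add_mem (Ideal.mul_mem_left _ _ ha) (Ideal.mul_mem_left _ _ hy))
      (Ideal.mul_mem_left _ _ hm)
  obtain ⟨r, hr⟩ := hsr a y m hm0 htop
  refine ⟨Ideal.Quotient.mk _ r, ?_⟩
  rw [Ideal.eq_top_iff_one, Ideal.mem_span_pair] at hr
  obtain ⟨p, q, hpq⟩ := hr
  have hmm : (Ideal.Quotient.mk (Ideal.span ({m} : Set R))) m = 0 :=
    Ideal.Quotient.eq_zero_iff_mem.2 (Ideal.mem_span_singleton_self m)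
  have := congrArg (Ideal.Quotient.mk (Ideal.span ({m} : Set R))) hpq
  simp only [map_add, map_mul, map_one, hmm, mul_zero, add_zero] at this
  exact IsUnit.of_mul_eq_one _ ((mul_comm _ _).trans this)

theorem zsr1_span {S : Type*} [CommRing S] (hS : ZSR1 S) (n : ℕ) :
    ∀ (a : Fin n → (Fin n → S)) (N : Submodule S (Fin n → S)),
      Submodule.span S (Set.range a) ⊔ N = ⊤ →
      ∃ b : Fin n → (Fin n → S), (∀ j, b j ∈ N) ∧
        Submodule.span S (Set.range (fun j => a j + b j)) = ⊤ := by
  induction n with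
  | zero =>
    intro a N _
    exact ⟨0, fun j => j.elim0, Subsingleton.elim _ _⟩
  | succ n ih =>
    intro a N h
    -- first coordinate
    have h1 : (Pi.single 0 1 : Fin (n+1) → S) ∈ Submodule.span S (Set.range a) ⊔ N := by
      rw [h]; trivial
    obtain ⟨p, hp, q, hq, hpq⟩ := Submodule.mem_sup.1 h1
    obtain ⟨c, rfl⟩ := (Submodule.mem_span_range_iff_exists_fun S).1 hp
    have h0 := congrFun hpq 0
    simp only [Fin.sum_univ_succ, Pi.add_apply, Pi.smul_apply, smul_eq_mul, Pi.single_eq_same,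
      Finset.sum_apply] at h0
    obtain ⟨z, hz⟩ := hS (a 0 0) (∑ j : Fin n, c j.succ * a j.succ 0 + q 0)
      ⟨c 0, 1, by linear_combination h0⟩
    set v : Fin (n+1) → S := a 0 + ∑ j : Fin n, (z * c j.succ) • a j.succ + z • q with hv
    have hv0 : v 0 = a 0 0 + (∑ j : Fin n, c j.succ * a j.succ 0 + q 0) * z := by
      simp only [hv, Pi.add_apply, Pi.smul_apply, smul_eq_mul, Finset.sum_apply, add_mul,
        Finset.sum_mul]
      rw [add_assoc, mul_comm z (q 0)]
      congr 2
      exact Finset.sum_congr rfl fun j _ => by ring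
    rw [← hv0] at hz
    obtain ⟨w, hw⟩ := hz.exists_right_inv
    let π : (Fin (n+1) → S) →ₗ[S] (Fin n → S) :=
      { toFun := fun x i => x i.succ - x 0 * w * v i.succ
        map_add' := fun x y => by ext i; simp; ring
        map_smul' := fun r x => by ext i; simp; ring }
    have hπ : ∀ x i, π x i = x i.succ - x 0 * w * v i.succ := fun _ _ => rfl
    have hπv : π v = 0 := by
      ext i
      rw [hπ, hw]; simp
    have hker : ∀ x, π x = 0 → x = (x 0 * w) • v := by
      intro x hx
      ext i
      refine Fin.cases ?_ (fun i => ?_) i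
      · simp only [Pi.smul_apply, smul_eq_mul]; linear_combination - x 0 * hw
      · have := congrFun hx i
        rw [hπ] at this
        simp only [Pi.smul_apply, smul_eq_mul]; simpa [sub_eq_zero] using this
    have hsurj : Function.Surjective π := by
      intro y
      refine ⟨Fin.cons 0 y, ?_⟩
      ext i
      rw [hπ]; simp
    have hπq : π q ∈ N.map π := Submodule.mem_map_of_mem hq
    have hπtop : Submodule.span S (Set.range fun j : Fin n => π (a j.succ)) ⊔ N.map π = ⊤ := by
      have hmap := congrArg (Submodule.map π) h
      rw [Submodule.map_sup, Submodule.map_span, Submodule.map_top,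
        LinearMap.range_eq_top.2 hsurj] at hmap
      rw [eq_top_iff, ← hmap]
      refine sup_le (Submodule.span_le.2 ?_) le_sup_right
      rintro _ ⟨_, ⟨j, rfl⟩, rfl⟩
      have hs : ∀ j : Fin n, π (a j.succ) ∈
          Submodule.span S (Set.range fun j : Fin n => π (a j.succ)) ⊔ N.map π := fun j =>
        Submodule.mem_sup_left (Submodule.subset_span ⟨j, rfl⟩)
      refine Fin.cases ?_ (fun j => hs j) j
      have ha0 : a 0 = v - ∑ j : Fin n, (z * c j.succ) • a j.succ - z • q := by
        rw [hv]; abel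
      rw [ha0, map_sub, map_sub, hπv, map_sum, map_smul]
      refine sub_mem (sub_mem (zero_mem _) (sum_mem fun j _ => ?_))
        (Submodule.smul_mem _ _ (Submodule.mem_sup_right hπq))
      rw [map_smul]
      exact Submodule.smul_mem _ _ (hs j)
    obtain ⟨b', hb', hspan⟩ := ih _ _ hπtop
    choose b hbN hb using fun j => Submodule.mem_map.1 (hb' j)
    refine ⟨Fin.cons (z • q - ∑ j : Fin n, (z * c j.succ) • b j) b, ?_, ?_⟩
    · intro j
      refine Fin.cases ?_ (fun j => ?_) j
      · simp only [Fin.cons_zero]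
        exact sub_mem (N.smul_mem _ hq) (sum_mem fun j _ => N.smul_mem _ (hbN j))
      · simpa using hbN j
    · set d : Fin (n+1) → (Fin (n+1) → S) :=
        Fin.cons (z • q - ∑ j : Fin n, (z * c j.succ) • b j) b with hd
      set T := Submodule.span S (Set.range fun j => a j + d j) with hT
      have hTs : ∀ j : Fin n, a j.succ + b j ∈ T := fun j =>
        Submodule.subset_span ⟨j.succ, by simp [hd]⟩
      have hT0 : a 0 + (z • q - ∑ j : Fin n, (z * c j.succ) • b j) ∈ T :=
        Submodule.subset_span ⟨0, by simp [hd]⟩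
      have hvT : v ∈ T := by
        have e : v = (a 0 + (z • q - ∑ j : Fin n, (z * c j.succ) • b j)) +
            ∑ j : Fin n, (z * c j.succ) • (a j.succ + b j) := by
          simp only [smul_add, Finset.sum_add_distrib]
          rw [hv]; abel
        rw [e]
        exact add_mem hT0 (sum_mem fun j _ => T.smul_mem _ (hTs j))
      rw [eq_top_iff]
      intro x _
      have hx : π x ∈ Submodule.span S (Set.range fun j : Fin n => π (a j.succ) + b' j) := by
        rw [hspan]; trivial
      obtain ⟨e, he⟩ := (Submodule.mem_span_range_iff_exists_fun S).1 hx
      have hk : π (x - ∑ j, e j • (a j.succ + b j)) = 0 := by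
        rw [map_sub, ← he, map_sum, sub_eq_zero]
        exact Finset.sum_congr rfl fun j _ => by rw [map_smul, map_add, hb]
      have := hker _ hk
      rw [sub_eq_iff_eq_add] at this
      rw [this]
      exact add_mem (T.smul_mem _ hvT) (sum_mem fun j _ => T.smul_mem _ (hTs j))

/-- The inverse of `H` preserves the column module of `Φ` if `H` does (Cayley-Hamilton). -/
theorem zinv {S : Type*} [CommRing S] {n : ℕ} (H F S0 : Matrix (Fin n) (Fin n) S)
    (hH : IsUnit H) (h : H * F = F * S0) : ∃ T, F = H * F * T := by
  have hpow : ∀ p : Polynomial S, Polynomial.aeval H p * F = F * Polynomial.aeval S0 p := by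
    intro p
    induction p using Polynomial.induction_on' with
    | add p q hp hq => rw [map_add, map_add, add_mul, mul_add, hp, hq]
    | monomial k r =>
      have : H ^ k * F = F * S0 ^ k := by
        induction k with
        | zero => simp
        | succ k ih => rw [pow_succ, pow_succ, mul_assoc, h, ← mul_assoc, ih, mul_assoc]
      rw [Polynomial.aeval_monomial, Polynomial.aeval_monomial, mul_assoc, this,
        ← mul_assoc, ← mul_assoc, Algebra.commutes r F]
  have hu : IsUnit (H.charpoly.coeff 0) := by
    have hd := (Matrix.isUnit_iff_isUnit_det H).1 hH
    rw [Matrix.det_eq_sign_charpoly_coeff] at hd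
    exact isUnit_of_mul_isUnit_right hd
  obtain ⟨w, hw⟩ := hu.exists_left_inv
  have hch := Matrix.aeval_self_charpoly H
  rw [← Polynomial.divX_mul_X_add H.charpoly, map_add, map_mul, Polynomial.aeval_X,
    Polynomial.aeval_C] at hch
  set P := Polynomial.aeval H H.charpoly.divX with hP
  have hc : P * H = H * P := by
    have e := (Polynomial.X_mul (p := H.charpoly.divX))
    have := congrArg (Polynomial.aeval H) e
    simpa using this.symm
  have h2 : H * P * F = - (H.charpoly.coeff 0 • F) := by
    rw [← hc, eq_neg_of_add_eq_zero_left hch, neg_mul, Algebra.smul_def]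
  refine ⟨- (w • Polynomial.aeval S0 H.charpoly.divX), ?_⟩
  rw [mul_neg, Matrix.mul_smul, Matrix.mul_assoc, ← hpow, ← Matrix.mul_assoc, h2, smul_neg,
    neg_neg, smul_smul, hw, one_smul]

theorem zmain {S : Type*} [CommRing S] (hS : ZSR1 S) {n : ℕ} (H F S0 : Matrix (Fin n) (Fin n) S)
    (hH : IsUnit H) (h : H * F = F * S0) : ∃ U, IsUnit U ∧ H * F = F * U := by
  obtain ⟨T, hT⟩ := zinv H F S0 hH h
  obtain ⟨b, hb, hspan⟩ := zsr1_span hS n (fun j => S0.col j) (LinearMap.ker F.mulVecLin) (by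
    rw [eq_top_iff]
    intro x _
    refine Submodule.mem_sup.2 ⟨S0.mulVec (T.mulVec x), ?_, x - S0.mulVec (T.mulVec x), ?_, by abel⟩
    · have : S0.mulVec (T.mulVec x) ∈ LinearMap.range S0.mulVecLin := ⟨_, rfl⟩
      rwa [Matrix.range_mulVecLin] at this
    · rw [LinearMap.mem_ker, Matrix.mulVecLin_apply, Matrix.mulVec_sub, Matrix.mulVec_mulVec,
        Matrix.mulVec_mulVec, ← h, ← hT, sub_self])
  let B : Matrix (Fin n) (Fin n) S := Matrix.of fun i j => b j i
  have hFB : F * B = 0 := by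
    ext i j
    exact congrFun (LinearMap.mem_ker.1 (hb j)) i
  refine ⟨S0 + B, ?_, by rw [mul_add, hFB, add_zero, h]⟩
  have hr : LinearMap.range (S0 + B).mulVecLin = ⊤ := by
    rw [Matrix.range_mulVecLin]
    exact hspan
  rw [LinearMap.range_eq_top] at hr
  exact Matrix.mulVec_surjective_iff_isUnit.1 hr

theorem zelisko_sufficiency
    {R : Type*} [CommRing R] [IsDomain R] [IsBezout R]
    (hsr : HasStableRange15 R)
    (m : R) (hm0 : m ≠ 0) (hmu : ¬ IsUnit m)
    (n t k : ℕ) (ht : 1 < t) (htk : t ≤ k) (hkn : k < n)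
    (φ : ℕ → R ⧸ Ideal.span ({m} : Set R))
    (hchain : ∀ i, t ≤ i → i < k → φ i ∣ φ (i + 1))
    (hφk : φ k ≠ 0) (hφt : ¬ IsUnit (φ t))
    (Φ : Matrix (Fin n) (Fin n) (R ⧸ Ideal.span ({m} : Set R)))
    (hΦ : Φ = Matrix.diagonal (fun i : Fin n =>
      if (i : ℕ) + 1 < t then 1
      else if (i : ℕ) + 1 ≤ k then φ ((i : ℕ) + 1) else 0))
    (g : ℕ → R ⧸ Ideal.span ({m} : Set R))
    (hg : ∀ l, t ≤ l → l < k → IsGeneratingSolution (φ l) (φ (l + 1)) (g l))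
    (αk : R ⧸ Ideal.span ({m} : Set R))
    (hαk : ∀ y : R ⧸ Ideal.span ({m} : Set R), φ k * y = 0 ↔ αk ∣ y)
    (α : ℕ → R ⧸ Ideal.span ({m} : Set R))
    (hα : ∀ j, t ≤ j → j ≤ k → α j = (∏ l ∈ Finset.Ico j k, g l) * αk)
    (H : Matrix (Fin n) (Fin n) (R ⧸ Ideal.span ({m} : Set R)))
    (hH : IsUnit H)
    (h31 : ∀ i j : Fin n, k < (i : ℕ) + 1 → (j : ℕ) + 1 < t → H i j = 0)
    (h21 : ∀ i j : Fin n, t ≤ (i : ℕ) + 1 → (i : ℕ) + 1 ≤ k → (j : ℕ) + 1 < t →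
      φ ((i : ℕ) + 1) ∣ H i j)
    (h22 : ∀ i j : Fin n, t ≤ (j : ℕ) + 1 → (j : ℕ) + 1 < (i : ℕ) + 1 → (i : ℕ) + 1 ≤ k →
      (∏ l ∈ Finset.Ico ((j : ℕ) + 1) ((i : ℕ) + 1), g l) ∣ H i j)
    (h32 : ∀ i j : Fin n, k < (i : ℕ) + 1 → t ≤ (j : ℕ) + 1 → (j : ℕ) + 1 ≤ k →
      α ((j : ℕ) + 1) ∣ H i j) :
    ∃ S : Matrix (Fin n) (Fin n) (R ⧸ Ideal.span ({m} : Set R)),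
      IsUnit S ∧ H * Φ = Φ * S := by
  have hprod : ∀ j i, t ≤ j → j ≤ i → i ≤ k → φ j * ∏ l ∈ Finset.Ico j i, g l = φ i := by
    intro j i htj hji
    induction i, hji using Nat.le_induction with
    | base => intro _; simp
    | succ i hji ih =>
      intro hik
      rw [Finset.prod_Ico_succ_top hji, ← mul_assoc, ih (by omega)]
      exact (hg i (by omega) (by omega)).1
  have hdvd : ∀ j i, t ≤ j → j ≤ i → i ≤ k → φ j ∣ φ i := fun j i h1 h2 h3 =>
    ⟨_, (hprod j i h1 h2 h3).symm⟩
  set δ : Fin n → R ⧸ Ideal.span ({m} : Set R) := fun i : Fin n =>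
      if (i : ℕ) + 1 < t then 1
      else if (i : ℕ) + 1 ≤ k then φ ((i : ℕ) + 1) else 0 with hδ
  have key : ∀ i j, δ i ∣ H i j * δ j := by
    intro i j
    simp only [hδ]
    by_cases hi1 : (i : ℕ) + 1 < t
    · simp [hi1]
    by_cases hj3 : k < (j : ℕ) + 1
    · have e1 : ¬ ((j : ℕ) + 1 < t) := by omega
      have e2 : ¬ ((j : ℕ) + 1 ≤ k) := by omega
      rw [if_neg e1, if_neg e2, mul_zero]; exact dvd_zero _
    by_cases hi2 : (i : ℕ) + 1 ≤ k
    · rw [if_neg hi1, if_pos hi2]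
      by_cases hj1 : (j : ℕ) + 1 < t
      · rw [if_pos hj1, mul_one]
        exact h21 i j (by omega) hi2 hj1
      rw [if_neg hj1, if_pos (by omega)]
      by_cases hji : (j : ℕ) + 1 < (i : ℕ) + 1
      · obtain ⟨c, hc⟩ := h22 i j (by omega) hji hi2
        refine ⟨c, ?_⟩
        rw [hc, ← hprod _ _ (by omega) hji.le hi2]
        ring
      · exact Dvd.dvd.mul_left (hdvd _ _ (by omega) (by omega) (by omega)) _
    · rw [if_neg hi1, if_neg hi2, zero_dvd_iff]
      by_cases hj1 : (j : ℕ) + 1 < t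
      · rw [h31 i j (by omega) hj1, zero_mul]
      rw [if_neg hj1, if_pos (by omega)]
      obtain ⟨c, hc⟩ := h32 i j (by omega) (by omega) (by omega)
      have hz := (hαk αk).2 dvd_rfl
      rw [hc, hα _ (by omega) (by omega)]
      rw [← hprod ((j : ℕ) + 1) k (by omega) (by omega) le_rfl] at hz
      linear_combination c * hz
  choose S0 hS0 using key
  refine zmain (zsr1_quot hsr m hm0) H Φ (Matrix.of S0) hH ?_
  rw [hΦ]
  ext i j
  rw [Matrix.mul_diagonal, Matrix.diagonal_mul, hS0]
  rfl
end

section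
/- Let 1 ≤ s < n and let Φ = diag(1, …, 1, 0, …, 0) ∈ R_m^{n×n} have exactly s diagonal entries equal to 1 followed by n−s zeros. Then a matrix H ∈ GL_n(R_m) belongs to the Zelisko group G_Φ if and only if H_{ij} = 0 for all indices with s < i ≤ n and 1 ≤ j ≤ s, i.e. G_Φ consists exactly of the invertible block upper triangular matrices [[M₁₁, M₁₂],[0, M₂₂]] with M₁₁ of size s×s and M₂₂ of size (n−s)×(n−s). -/
theorem zelisko_idempotent_case
    {R : Type*} [CommRing R] [IsDomain R] [IsBezout R]
    (hsr : HasStableRange15 R)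
    (m : R) (hm0 : m ≠ 0) (hmu : ¬ IsUnit m)
    (n s : ℕ) (hs : 1 ≤ s) (hsn : s < n)
    (Φ : Matrix (Fin n) (Fin n) (R ⧸ Ideal.span ({m} : Set R)))
    (hΦ : Φ = Matrix.diagonal (fun i : Fin n => if (i : ℕ) < s then 1 else 0))
    (H : Matrix (Fin n) (Fin n) (R ⧸ Ideal.span ({m} : Set R)))
    (hH : IsUnit H) :
    (∃ S : Matrix (Fin n) (Fin n) (R ⧸ Ideal.span ({m} : Set R)),
      IsUnit S ∧ H * Φ = Φ * S) ↔
    (∀ i j : Fin n, s ≤ (i : ℕ) → (j : ℕ) < s → H i j = 0) := by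
  subst hΦ
  constructor
  · rintro ⟨S, -, h⟩ i j hi hj
    have h1 := congrFun (congrFun h i) j
    rw [Matrix.mul_diagonal, Matrix.diagonal_mul] at h1
    simpa [hj, not_lt.mpr hi] using h1
  · intro h
    let S : Matrix (Fin n) (Fin n) (R ⧸ Ideal.span ({m} : Set R)) :=
      Matrix.of fun i j => if ((i : ℕ) < s ↔ (j : ℕ) < s) then H i j else 0
    have hdet : S.det = H.det := by
      rw [Matrix.twoBlockTriangular_det S (fun i : Fin n => (i : ℕ) < s)
          (fun i hi j hj => by simp [S, hi, hj]),
        Matrix.twoBlockTriangular_det H (fun i : Fin n => (i : ℕ) < s)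
          (fun i hi j hj => h i j (not_lt.mp hi) hj)]
      congr 2
      · ext i j
        simp [Matrix.toSquareBlockProp, S, i.2, j.2]
      · ext i j
        have hi := i.2
        have hj := j.2
        exact if_pos (iff_of_false hi hj)
    refine ⟨S, ?_, ?_⟩
    · rw [Matrix.isUnit_iff_isUnit_det] at hH ⊢
      rwa [hdet]
    · ext i j
      rw [Matrix.mul_diagonal, Matrix.diagonal_mul]
      by_cases hi : (i : ℕ) < s <;> by_cases hj : (j : ℕ) < s <;> simp [S, hi, hj]
      exact h i j (not_lt.mp hi) hj
end

section
/- Let Φ = diag(φ_1, …, φ_n) ∈ R_m^{n×n} with φ_1 | φ_2 | ⋯ | φ_n in R_m, φ_n ≠ 0, and φ_1 not a unit of R_m. For 1 ≤ l ≤ n−1 fix a generating solution g_l of the equation φ_l·x = φ_{l+1}. Then a matrix H ∈ GL_n(R_m) belongs to the Zelisko group G_Φ if and only if for all indices 1 ≤ j < i ≤ n the product g_j·g_{j+1}⋯g_{i−1} divides H_{ij} in R_m. -/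
theorem zel_phi {A : Type*} [CommRing A] (n : ℕ) (φ g : ℕ → A)
    (hg : ∀ l, 1 ≤ l → l < n → IsGeneratingSolution (φ l) (φ (l + 1)) (g l))
    (j : ℕ) (hj : 1 ≤ j) (i : ℕ) (hji : j ≤ i) :
    i ≤ n → φ i = φ j * ∏ l ∈ Finset.Ico j i, g l := by
  induction i, hji using Nat.le_induction with
  | base => simp
  | succ i hji ih =>
    intro hi
    rw [Finset.prod_Ico_succ_top hji, ← mul_assoc, ← ih (by omega)]
    exact (hg i (by omega) (by omega)).1.symm

theorem zel_ann {A : Type*} [CommRing A] (n : ℕ) (φ g : ℕ → A)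
    (hg : ∀ l, 1 ≤ l → l < n → IsGeneratingSolution (φ l) (φ (l + 1)) (g l))
    (j : ℕ) (hj : 1 ≤ j) (z : A) (hz : φ j * z = 0) (i : ℕ) (hji : j ≤ i) :
    i ≤ n → ∃ w, z = (∏ l ∈ Finset.Ico j i, g l) * w ∧ φ i * w = 0 := by
  induction i, hji using Nat.le_induction with
  | base => intro _; exact ⟨z, by simp, hz⟩
  | succ i hji ih =>
    intro hi
    obtain ⟨w, hw, hw0⟩ := ih (by omega)
    obtain ⟨h1, h2⟩ := hg i (by omega) (by omega)
    have h3 : g i ∣ g i + w := h2 _ (by rw [mul_add, h1, hw0, add_zero])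
    obtain ⟨v, hv⟩ := (dvd_add_right (dvd_refl (g i))).1 h3
    refine ⟨v, ?_, ?_⟩
    · rw [Finset.prod_Ico_succ_top hji, hw, hv, mul_assoc]
    · rw [← h1, mul_assoc, ← hv, hw0]

theorem zelisko_full_diagonal_case
    {R : Type*} [CommRing R] [IsDomain R] [IsBezout R]
    (hsr : HasStableRange15 R)
    (m : R) (hm0 : m ≠ 0) (hmu : ¬ IsUnit m)
    (n : ℕ) (hn : 1 ≤ n)
    (φ : ℕ → R ⧸ Ideal.span ({m} : Set R))
    (hchain : ∀ l, 1 ≤ l → l < n → φ l ∣ φ (l + 1))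
    (hφn : φ n ≠ 0) (hφ1 : ¬ IsUnit (φ 1))
    (Φ : Matrix (Fin n) (Fin n) (R ⧸ Ideal.span ({m} : Set R)))
    (hΦ : Φ = Matrix.diagonal (fun i : Fin n => φ ((i : ℕ) + 1)))
    (g : ℕ → R ⧸ Ideal.span ({m} : Set R))
    (hg : ∀ l, 1 ≤ l → l < n → IsGeneratingSolution (φ l) (φ (l + 1)) (g l))
    (H : Matrix (Fin n) (Fin n) (R ⧸ Ideal.span ({m} : Set R)))
    (hH : IsUnit H) :
    (∃ S : Matrix (Fin n) (Fin n) (R ⧸ Ideal.span ({m} : Set R)),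
      IsUnit S ∧ H * Φ = Φ * S) ↔
    (∀ i j : Fin n, (j : ℕ) + 1 < (i : ℕ) + 1 →
      (∏ l ∈ Finset.Ico ((j : ℕ) + 1) ((i : ℕ) + 1), g l) ∣ H i j) := by
  subst hΦ
  constructor
  · rintro ⟨S, -, hS⟩ i j hij
    have e := congrFun (congrFun hS i) j
    rw [Matrix.mul_diagonal, Matrix.diagonal_mul] at e
    have hi : (i : ℕ) + 1 ≤ n := i.2
    rw [zel_phi n φ g hg (j + 1) (by omega) (i + 1) hij.le hi] at e
    obtain ⟨w, hw, -⟩ := zel_ann n φ g hg (j + 1) (by omega)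
      (H i j - (∏ l ∈ Finset.Ico ((j : ℕ) + 1) ((i : ℕ) + 1), g l) * S i j)
      (by linear_combination e) (i + 1) hij.le hi
    exact ⟨S i j + w, by linear_combination hw⟩
  · intro hd
    have hlift : ∀ l, ∃ x : R, x ≠ 0 ∧ Ideal.Quotient.mk (Ideal.span ({m} : Set R)) x = g l := by
      intro l
      obtain ⟨x, hx⟩ := Ideal.Quotient.mk_surjective (g l)
      by_cases h0 : x = 0
      · refine ⟨m, hm0, ?_⟩
        rw [← hx, h0, map_zero, Ideal.Quotient.eq_zero_iff_mem]
        exact Ideal.mem_span_singleton_self m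
      · exact ⟨x, h0, hx⟩
    choose γ hγ0 hγ using hlift
    let E : ℕ → R := fun i => ∏ l ∈ Finset.Ico 1 (i + 1), γ l
    have hE0 : ∀ i, E i ≠ 0 := fun i => Finset.prod_ne_zero_iff.2 fun l _ => hγ0 l
    have hEE : ∀ i j : ℕ, j ≤ i → E i = E j * ∏ l ∈ Finset.Ico (j + 1) (i + 1), γ l := by
      intro i j hij
      exact (Finset.prod_Ico_consecutive γ (by omega) (by omega)).symm
    have hex : ∀ i j : Fin n, ∃ h s : R,
        Ideal.Quotient.mk (Ideal.span ({m} : Set R)) h = H i j ∧ h * E j = E i * s := by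
      intro i j
      rcases lt_or_ge (j : ℕ) (i : ℕ) with hij | hij
      · obtain ⟨k, hk⟩ := hd i j (by omega)
        obtain ⟨k, rfl⟩ := Ideal.Quotient.mk_surjective k
        refine ⟨(∏ l ∈ Finset.Ico ((j : ℕ) + 1) ((i : ℕ) + 1), γ l) * k, k, ?_, ?_⟩
        · rw [hk, map_mul, map_prod]
          simp only [hγ]
        · rw [hEE i j hij.le]; ring
      · obtain ⟨k, hk⟩ := Ideal.Quotient.mk_surjective (H i j)
        refine ⟨k, (∏ l ∈ Finset.Ico ((i : ℕ) + 1) ((j : ℕ) + 1), γ l) * k, hk, ?_⟩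
        rw [hEE j i hij]; ring
    choose h s hh hs using hex
    let π := Ideal.Quotient.mk (Ideal.span ({m} : Set R))
    have hHm : π.mapMatrix (Matrix.of h) = H := by
      ext i j; exact hh i j
    have hmat : Matrix.of h * Matrix.diagonal (fun i : Fin n => E i)
        = Matrix.diagonal (fun i : Fin n => E i) * Matrix.of s := by
      ext i j
      rw [Matrix.mul_diagonal, Matrix.diagonal_mul]
      exact hs i j
    have hdet : (Matrix.of h).det = (Matrix.of s).det := by
      have h1 := congrArg Matrix.det hmat
      rw [Matrix.det_mul, Matrix.det_mul, mul_comm] at h1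
      refine mul_left_cancel₀ ?_ h1
      rw [Matrix.det_diagonal]
      exact Finset.prod_ne_zero_iff.2 fun i _ => hE0 i
    refine ⟨π.mapMatrix (Matrix.of s), ?_, ?_⟩
    · rw [Matrix.isUnit_iff_isUnit_det, ← RingHom.map_det, ← hdet, RingHom.map_det, hHm]
      exact (Matrix.isUnit_iff_isUnit_det _).1 hH
    · have hφE : ∀ i : Fin n, φ ((i : ℕ) + 1) = φ 1 * π (E i) := by
        intro i
        rw [zel_phi n φ g hg 1 le_rfl (i + 1) (by omega) i.2, map_prod]
        simp only [π, hγ]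
      ext i j
      rw [Matrix.mul_diagonal, Matrix.diagonal_mul, hφE, hφE, ← hh i j]
      have h2 : π (h i j) * π (E j) = π (E i) * π (s i j) := by
        rw [← map_mul, hs i j, map_mul]
      change π (h i j) * _ = _ * π (s i j)
      linear_combination φ 1 * h2
end
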